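/- For the ideal Bose gas, the pressure p_+(μ) = -(1/(β(2π)^d)) ∫ d^d k log(1 - e^{-β ε(k) + β μ}) is finite, convex and increasing for μ < 0, and its limit as μ → 0⁻ is finite when d > γ (where ε(k) ≈ |k|^γ near 0). -/

import Mathlib

open MeasureTheory Real

/-- In a nontrivial finite-dimensional space, `‖x‖ ^ s * exp (-b * ‖x‖ ^ q)` is integrable as soon
as `s` exceeds minus the dimension. -/
lemma integrable_norm_rpow_mul_exp_neg_mul_norm_rpow {E : Type*} [NormedAddCommGroup E]
    [NormedSpace ℝ E] [FiniteDimensional ℝ E] [Nontrivial E] [MeasurableSpace E] [BorelSpace E]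
    (ν : Measure E) [ν.IsAddHaarMeasure] {s q b : ℝ}
    (hs : -(Module.finrank ℝ E : ℝ) < s) (hq : 0 < q) (hb : 0 < b) :
    Integrable (fun x : E => ‖x‖ ^ s * exp (-b * ‖x‖ ^ q)) ν := by
  rw [integrable_fun_norm_addHaar ν (f := fun r => r ^ s * exp (-b * r ^ q))]
  have hdim : 1 ≤ Module.finrank ℝ E := Module.finrank_pos
  refine (integrableOn_rpow_mul_exp_neg_mul_rpow
    (s := ((Module.finrank ℝ E - 1 : ℕ) : ℝ) + s) ?_ hq hb).congr_fun ?_ measurableSet_Ioi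
  · push_cast [hdim]
    linarith
  · intro r hr
    have hr : 0 < r := hr
    simp only [smul_eq_mul]
    rw [rpow_add hr, rpow_natCast, mul_assoc]

lemma neg_log_one_sub_exp_neg_pos {x : ℝ} (hx : 0 < x) : 0 < -log (1 - exp (-x)) := by
  have h1 : exp (-x) < 1 := exp_lt_one_iff.2 (by linarith)
  have := log_neg (sub_pos.2 h1) (by linarith [exp_pos (-x)])
  linarith

lemma neg_log_one_sub_exp_neg_lt {x y : ℝ} (hx : 0 < x) (hxy : x < y) :
    -log (1 - exp (-y)) < -log (1 - exp (-x)) := by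
  have h1 : exp (-x) < 1 := exp_lt_one_iff.2 (by linarith)
  have h2 : exp (-y) < exp (-x) := exp_lt_exp.2 (by linarith)
  exact neg_lt_neg (log_lt_log (by linarith) (by linarith))

lemma neg_log_one_sub_exp_neg_le {x : ℝ} (hx : 0 < x) :
    -log (1 - exp (-x)) ≤ exp (-(x / 2)) / x := by
  have h1 : exp (-x) < 1 := exp_lt_one_iff.2 (by linarith)
  have h := one_sub_inv_le_log_of_pos (sub_pos.2 h1)
  have hsinh : x / 2 ≤ sinh (x / 2) := self_le_sinh_iff.2 (by linarith)
  rw [sinh_eq] at hsinh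
  have hsq : exp (-x) = exp (-(x / 2)) * exp (-(x / 2)) := by rw [← exp_add]; ring_nf
  have hone : exp (x / 2) * exp (-(x / 2)) = 1 := by rw [← exp_add]; simp
  have hpos := exp_pos (-(x / 2))
  have key : x * exp (-(x / 2)) ≤ 1 - exp (-x) := by nlinarith
  have hinv : (1 - exp (-x))⁻¹ - 1 = exp (-x) / (1 - exp (-x)) := by
    have : 1 - exp (-x) ≠ 0 := by linarith
    field_simp
    ring
  calc -log (1 - exp (-x)) ≤ exp (-x) / (1 - exp (-x)) := by linarith
    _ ≤ exp (-(x / 2)) / x := by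
      rw [div_le_div_iff₀ (by linarith) hx, hsq]
      rw [hsq] at key
      nlinarith

lemma convexOn_neg_log_one_sub_exp :
    ConvexOn ℝ (Set.Iio (0 : ℝ)) fun y => -log (1 - exp y) := by
  refine ⟨convex_Iio 0, fun x hx y hy a b ha hb hab => ?_⟩
  have hx : exp x < 1 := exp_lt_one_iff.2 hx
  have hy : exp y < 1 := exp_lt_one_iff.2 hy
  have hexp := convexOn_exp.2 (Set.mem_univ x) (Set.mem_univ y) ha hb hab
  have hlog := strictConcaveOn_log_Ioi.concaveOn.2 (x := 1 - exp x) (y := 1 - exp y)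
    (sub_pos.2 hx) (sub_pos.2 hy) ha hb hab
  have hmem : 0 < a • (1 - exp x) + b • (1 - exp y) :=
    (convex_Ioi (0 : ℝ)) (sub_pos.2 hx) (sub_pos.2 hy) ha hb hab
  simp only [smul_eq_mul] at *
  have hmono : log (a * (1 - exp x) + b * (1 - exp y)) ≤ log (1 - exp (a * x + b * y)) :=
    log_le_log hmem (by linarith)
  linarith

/-- **Ideal Bose gas pressure.**
For `β > 0` and a one-particle energy `ε` on `ℝ^d` comparable to `‖k‖^γ` near `0`
and growing at least like `‖k‖^α` at infinity, the Bose pressure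
`p₊(μ) = -(1/(β(2π)^d)) ∫ log(1 - e^{-βε(k)+βμ}) dk`
is finite (the integrand is integrable) for every `μ < 0`, convex and
(strictly) increasing on `(-∞,0)`, and if `d > γ` its limit as `μ → 0⁻` is
finite. -/
theorem bose_pressure_finite_convex_mono_limit
    (d : ℕ) (hd : 1 ≤ d) (β α γ c₁ c₂ : ℝ)
    (hβ : 0 < β) (hα : 0 < α) (hγ : 0 < γ) (hc₁ : 0 < c₁) (hc₂ : 0 < c₂)
    (ε : EuclideanSpace ℝ (Fin d) → ℝ)
    (hεcont : Continuous ε) (hε0 : ε 0 = 0)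
    (hεpos : ∀ k, k ≠ 0 → 0 < ε k)
    (hεsmall : ∀ k : EuclideanSpace ℝ (Fin d), ‖k‖ ≤ 1 →
      c₁ * ‖k‖ ^ γ ≤ ε k ∧ ε k ≤ c₂ * ‖k‖ ^ γ)
    (hεlarge : ∀ k : EuclideanSpace ℝ (Fin d), 1 ≤ ‖k‖ → ‖k‖ ^ α ≤ ε k)
    (p : ℝ → ℝ)
    (hp : ∀ μ : ℝ, p μ = -(1 / (β * (2 * π) ^ d)) *
      ∫ k : EuclideanSpace ℝ (Fin d),
        Real.log (1 - Real.exp (-β * ε k + β * μ))) :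
    (∀ μ : ℝ, μ < 0 →
        Integrable (fun k : EuclideanSpace ℝ (Fin d) =>
          Real.log (1 - Real.exp (-β * ε k + β * μ)))) ∧
      ConvexOn ℝ (Set.Iio (0 : ℝ)) p ∧
      StrictMonoOn p (Set.Iio (0 : ℝ)) ∧
      (γ < (d : ℝ) → ∃ L : ℝ,
        Filter.Tendsto p (nhdsWithin 0 (Set.Iio (0 : ℝ))) (nhds L)) := by
  have hdim : Module.finrank ℝ (EuclideanSpace ℝ (Fin d)) = d := finrank_euclideanSpace_fin
  have : NeZero d := ⟨by omega⟩
  have hd' : (1 : ℝ) ≤ d := by exact_mod_cast hd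
  have hε_nonneg : ∀ k, 0 ≤ ε k := fun k => by
    rcases eq_or_ne k 0 with rfl | hk
    · exact hε0.ge
    · exact (hεpos k hk).le
  set b : ℝ := β / 2 with hb
  have hb0 : 0 < b := by positivity
  have hdecay : ∀ k, exp (-(b * ε k)) ≤ exp b * exp (-b * ‖k‖ ^ α) := fun k => by
    rw [← exp_add, exp_le_exp]
    rcases le_total ‖k‖ 1 with hk | hk
    · nlinarith [rpow_le_one (norm_nonneg k) hk hα.le, hε_nonneg k]
    · nlinarith [hεlarge k hk]
  have hintexp : Integrable fun k : EuclideanSpace ℝ (Fin d) => exp (-b * ‖k‖ ^ α) := by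
    simpa using integrable_norm_rpow_mul_exp_neg_mul_norm_rpow
      (volume : Measure (EuclideanSpace ℝ (Fin d))) (s := 0) (by rw [hdim]; linarith) hα hb0
  set f : ℝ → EuclideanSpace ℝ (Fin d) → ℝ :=
    fun μ k => -log (1 - exp (-(β * ε k - β * μ))) with hf
  have harg : ∀ {μ : ℝ}, μ < 0 → ∀ k, 0 < β * ε k - β * μ := fun hμ k => by
    nlinarith [hε_nonneg k, mul_pos_of_neg_of_neg (neg_neg_of_pos hβ) hμ]
  have hf_meas : ∀ μ, Measurable (f μ) := fun μ => by
    have := hεcont.measurable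
    fun_prop
  have hf_int : ∀ μ : ℝ, μ < 0 → Integrable (f μ) := fun μ hμ => by
    have hβμ : 0 < -(β * μ) := by nlinarith
    refine (hintexp.const_mul (exp b / -(β * μ))).mono' (hf_meas μ).aestronglyMeasurable
      (.of_forall fun k => ?_)
    rw [norm_of_nonneg (neg_log_one_sub_exp_neg_pos (harg hμ k)).le]
    refine (neg_log_one_sub_exp_neg_le (harg hμ k)).trans ?_
    rw [div_mul_eq_mul_div]
    refine div_le_div₀ (by positivity) (le_trans (exp_le_exp.2 ?_) (hdecay k)) hβμ ?_
    · rw [hb]; linarith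
    · nlinarith [hε_nonneg k]
  set C : ℝ := 1 / (β * (2 * π) ^ d)
  have hC : 0 < C := by positivity
  have hpf : ∀ μ, p μ = C * ∫ k, f μ k := fun μ => by
    rw [hp, hf, integral_neg, mul_neg, neg_mul]
    congr! 7
    ring
  have hmono : StrictMonoOn p (Set.Iio (0 : ℝ)) := by
    intro μ hμ ν hν hμν
    have hlt : ∀ k, f μ k < f ν k := fun k =>
      neg_log_one_sub_exp_neg_lt (harg hν k) (by nlinarith)
    rw [hpf, hpf]
    refine mul_lt_mul_of_pos_left ?_ hC
    rw [← sub_pos, ← integral_sub (hf_int ν hν) (hf_int μ hμ),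
      integral_pos_iff_support_of_nonneg (fun k => (sub_pos.2 (hlt k)).le)
        ((hf_int ν hν).sub (hf_int μ hμ)),
      show (Function.support fun k => f ν k - f μ k) = Set.univ from
        Set.eq_univ_of_forall fun k => (sub_pos.2 (hlt k)).ne']
    exact Measure.measure_univ_pos.2 (NeZero.ne _)
  refine ⟨fun μ hμ => ?_, ⟨convex_Iio 0, fun μ hμ ν hν s t hs ht hst => ?_⟩, hmono, fun hγd => ?_⟩
  · refine (hf_int μ hμ).neg.congr (.of_forall fun k => ?_)
    simp only [hf, Pi.neg_apply, neg_neg]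
    ring_nf
  · have hst0 : s • μ + t • ν < 0 := (convex_Iio (0 : ℝ)) hμ hν hs ht hst
    have hint := ((hf_int μ hμ).const_mul s).add ((hf_int ν hν).const_mul t)
    have hle : ∫ k, f (s • μ + t • ν) k ≤ ∫ k, (s * f μ k + t * f ν k) := by
      refine integral_mono (hf_int _ hst0) hint fun k => ?_
      have := convexOn_neg_log_one_sub_exp.2 (x := -(β * ε k - β * μ)) (y := -(β * ε k - β * ν))
        (neg_lt_zero.2 (harg hμ k)) (neg_lt_zero.2 (harg hν k)) hs ht hst
      simp only [smul_eq_mul] at this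
      have heq : s * -(β * ε k - β * μ) + t * -(β * ε k - β * ν)
          = -(β * ε k - β * (s * μ + t * ν)) := by
        linear_combination (-β * ε k) * hst
      rw [heq] at this
      exact this
    rw [integral_add ((hf_int μ hμ).const_mul s) ((hf_int ν hν).const_mul t),
      integral_const_mul, integral_const_mul] at hle
    simp only [hpf, smul_eq_mul] at hle ⊢
    nlinarith
  · set B : EuclideanSpace ℝ (Fin d) → ℝ := fun k =>
      exp b / β * (c₁⁻¹ * (‖k‖ ^ (-γ) * exp (-b * ‖k‖ ^ α)) + exp (-b * ‖k‖ ^ α)) with hB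
    have hB_int : Integrable B :=
      (((integrable_norm_rpow_mul_exp_neg_mul_norm_rpow _ (by rw [hdim]; linarith) hα
        hb0).const_mul _).add hintexp).const_mul _
    have hinv : ∀ k, k ≠ 0 → (ε k)⁻¹ ≤ c₁⁻¹ * ‖k‖ ^ (-γ) + 1 := fun k hk => by
      have hk0 : 0 < ‖k‖ := norm_pos_iff.2 hk
      rcases le_total ‖k‖ 1 with hk1 | hk1
      · have := inv_anti₀ (by positivity) (hεsmall k hk1).1
        rw [mul_inv, ← rpow_neg hk0.le] at this
        linarith
      · have h1 : 1 ≤ ε k := (one_le_rpow hk1 hα.le).trans (hεlarge k hk1)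
        have := inv_le_one_of_one_le₀ h1
        have : 0 ≤ c₁⁻¹ * ‖k‖ ^ (-γ) := by positivity
        linarith
    have hfB : ∀ μ < 0, ∀ k, k ≠ 0 → f μ k ≤ B k := fun μ hμ k hk => by
      have hβε : 0 < β * ε k := mul_pos hβ (hεpos k hk)
      calc f μ k ≤ -log (1 - exp (-(β * ε k))) :=
            (neg_log_one_sub_exp_neg_lt hβε (by nlinarith)).le
        _ ≤ exp (-(β * ε k / 2)) / (β * ε k) := neg_log_one_sub_exp_neg_le hβε
        _ = exp (-(b * ε k)) * β⁻¹ * (ε k)⁻¹ := by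
          rw [hb, div_eq_mul_inv, mul_inv, ← mul_assoc]; ring_nf
        _ ≤ (exp b * exp (-b * ‖k‖ ^ α)) * β⁻¹ * (c₁⁻¹ * ‖k‖ ^ (-γ) + 1) := by
          have := hinv k hk
          have := hdecay k
          have := inv_nonneg.2 (hε_nonneg k)
          gcongr
        _ = B k := by rw [hB]; ring
    have hne : ∀ᵐ k : EuclideanSpace ℝ (Fin d), k ≠ 0 := Measure.ae_ne volume 0
    refine ⟨_, hmono.monotoneOn.tendsto_nhdsLT ⟨C * ∫ k, B k, ?_⟩⟩
    rintro _ ⟨μ, hμ, rfl⟩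
    rw [hpf]
    exact mul_le_mul_of_nonneg_left
      (integral_mono_ae (hf_int μ hμ) hB_int (hne.mono (hfB μ hμ))) hC.le
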